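/- Every left ideal of R properly containing J is principal, generated by a polynomial in c with nonzero constant term: if I is an R-submodule of R with J < I (strict containment), then there exists p ∈ K[x] with p(0) ≠ 0 such that I = Submodule.span R {p(c)}. -/

import Mathlib

noncomputable section

/-- The defining relation `X * Y = 1` of the Jacobson algebra. -/
inductive JRel (K : Type*) [Field K] : FreeAlgebra K (Fin 2) → FreeAlgebra K (Fin 2) → Prop
  | rel : JRel K (FreeAlgebra.ι K 0 * FreeAlgebra.ι K 1) 1

/-- The Jacobson algebra `K⟨X, Y | XY = 1⟩`. -/
abbrev Jacobson (K : Type*) [Field K] := RingQuot (JRel K)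

variable (K : Type*) [Field K]

/-- The generator `X` of the Jacobson algebra. -/
def Xg : Jacobson K := RingQuot.mkAlgHom K (JRel K) (FreeAlgebra.ι K 0)

/-- The generator `Y` of the Jacobson algebra. -/
def Yg : Jacobson K := RingQuot.mkAlgHom K (JRel K) (FreeAlgebra.ι K 1)

/-- The loop `c = Y²X`. -/
def cJ : Jacobson K := Yg K ^ 2 * Xg K

/-- `F` is the set of irreducible polynomials `f ∈ K[x]` with `f(0) = -1`. -/
def FSet : Set (Polynomial K) := {f | Irreducible f ∧ f.eval 0 = -1}

/-- The vertex idempotent `w = 1 - YX`. -/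
def wJ : Jacobson K := 1 - Yg K * Xg K

/-- The ghost loop `c* = YX²`. -/
def csJ : Jacobson K := Yg K * Xg K ^ 2

/-- The ghost exit edge `d* = X - YX²`. -/
def dsJ : Jacobson K := Xg K - Yg K * Xg K ^ 2

/-- The socle of the Jacobson algebra, as a left ideal:
`J = span_R ({w} ∪ {ds * cs^j : j ∈ ℕ})`. -/
def socJ : Submodule (Jacobson K) (Jacobson K) :=
  Submodule.span (Jacobson K) ({wJ K} ∪ Set.range fun j : ℕ => dsJ K * csJ K ^ j)

section JacobsonProof

open Polynomial

variable {K : Type*} [Field K]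

lemma XY_one : Xg K * Yg K = 1 := by
  have h := RingQuot.mkAlgHom_rel K (JRel.rel (K := K))
  simpa [Xg, Yg] using h

lemma XY_assoc (r : Jacobson K) : Xg K * (Yg K * r) = r := by
  rw [← mul_assoc, XY_one, one_mul]

lemma jac_induction {P : Jacobson K → Prop} (hK : ∀ a : K, P (algebraMap K (Jacobson K) a))
    (hX : P (Xg K)) (hY : P (Yg K)) (hadd : ∀ a b, P a → P b → P (a + b))
    (hmul : ∀ a b, P a → P b → P (a * b)) (r : Jacobson K) : P r := by
  obtain ⟨f, rfl⟩ := RingQuot.mkAlgHom_surjective K (JRel K) r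
  induction f using FreeAlgebra.induction with
  | grade0 a => simpa using hK a
  | grade1 i =>
    fin_cases i
    · exact hX
    · exact hY
  | mul a b ha hb => rw [map_mul]; exact hmul _ _ ha hb
  | add a b ha hb => rw [map_add]; exact hadd _ _ ha hb

lemma w_mul_Y : wJ K * Yg K = 0 := by
  simp [wJ, sub_mul, mul_assoc, XY_one]

lemma w_mul_Y_assoc (r : Jacobson K) : wJ K * (Yg K * r) = 0 := by
  rw [← mul_assoc, w_mul_Y, zero_mul]

lemma ds_cs (j : ℕ) : dsJ K * csJ K ^ j = wJ K * Xg K ^ (j + 1) := by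
  induction j with
  | zero => simp [dsJ, wJ, sub_mul, pow_two, mul_assoc]
  | succ j ih =>
    rw [pow_succ, ← mul_assoc, ih, csJ]
    rw [pow_succ (Xg K) j]
    simp only [mul_assoc, XY_assoc]
    rw [← pow_add]

lemma wX_mem (n : ℕ) : wJ K * Xg K ^ n ∈ socJ K := by
  cases n with
  | zero => exact Submodule.subset_span (Or.inl (by simp))
  | succ n => exact Submodule.subset_span (Or.inr ⟨n, ds_cs n⟩)

lemma socJ_le (I : Submodule (Jacobson K) (Jacobson K)) (h : ∀ n, wJ K * Xg K ^ n ∈ I) :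
    socJ K ≤ I := by
  refine Submodule.span_le.2 ?_
  rintro x (hx | ⟨j, rfl⟩)
  · rw [Set.mem_singleton_iff.1 hx]; simpa using h 0
  · show dsJ K * csJ K ^ j ∈ I
    rw [ds_cs]; exact h _

lemma wX_mul_Y (n : ℕ) : wJ K * Xg K ^ n * Yg K ∈ socJ K := by
  cases n with
  | zero => simp [w_mul_Y]
  | succ n =>
    rw [pow_succ, mul_assoc, mul_assoc, XY_one, mul_one]; exact wX_mem n

/-- The socle is stable under right multiplication. -/
lemma soc_mul (r : Jacobson K) : ∀ n, wJ K * Xg K ^ n * r ∈ socJ K := by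
  have key : ∀ r : Jacobson K, (∀ n, wJ K * Xg K ^ n * r ∈ socJ K) →
      ∀ j ∈ socJ K, j * r ∈ socJ K := by
    intro r hr j hj
    have : socJ K ≤ (socJ K).comap (LinearMap.toSpanSingleton (Jacobson K) (Jacobson K) r) :=
      socJ_le _ (fun n => by simpa using hr n)
    simpa using this hj
  refine jac_induction (P := fun r => ∀ n, wJ K * Xg K ^ n * r ∈ socJ K) ?_ ?_ ?_ ?_ ?_ r
  · intro a n
    rw [← Algebra.commutes]
    exact (socJ K).smul_mem _ (wX_mem n)
  · intro n
    rw [mul_assoc, ← pow_succ]; exact wX_mem _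
  · exact wX_mul_Y
  · intro a b ha hb n
    rw [mul_add]; exact add_mem (ha n) (hb n)
  · intro a b ha hb n
    rw [← mul_assoc]; exact key b hb _ (ha n)

lemma w_mul_mem (r : Jacobson K) : wJ K * r ∈ socJ K := by
  simpa using soc_mul r 0

lemma c_eq : cJ K = Yg K - Yg K * wJ K := by
  simp [cJ, wJ, mul_sub, pow_two, mul_assoc]

lemma Y_pow_mul (n : ℕ) (q : K[X]) :
    Yg K ^ n * aeval (cJ K) q - aeval (cJ K) (X ^ n * q) ∈ socJ K := by
  induction n generalizing q with
  | zero => simp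
  | succ n ih =>
    have h1 := ih (X * q)
    have h2 : Yg K ^ n * (Yg K * (wJ K * aeval (cJ K) q)) ∈ socJ K :=
      (socJ K).smul_mem _ ((socJ K).smul_mem _ (w_mul_mem _))
    have h3 := add_mem h1 h2
    have e : Yg K ^ n * aeval (cJ K) (X * q) + Yg K ^ n * (Yg K * (wJ K * aeval (cJ K) q))
        = Yg K ^ (n + 1) * aeval (cJ K) q := by
      rw [map_mul, aeval_X, pow_succ]
      nth_rewrite 1 [c_eq]
      simp only [sub_mul, mul_sub, mul_assoc]
      abel
    rw [← e, pow_succ, mul_assoc]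
    convert h3 using 1
    abel

/-- `r` is polynomial in `c` modulo the socle after multiplication by a power of `Y`. -/
def GoodJ (r : Jacobson K) : Prop :=
  ∃ (n : ℕ) (q : K[X]), Yg K ^ n * r - aeval (cJ K) q ∈ socJ K

lemma good_raise {r : Jacobson K} {n : ℕ} {q : K[X]} (m : ℕ)
    (h : Yg K ^ n * r - aeval (cJ K) q ∈ socJ K) :
    Yg K ^ (m + n) * r - aeval (cJ K) (X ^ m * q) ∈ socJ K := by
  have h1 := add_mem ((socJ K).smul_mem (Yg K ^ m) h) (Y_pow_mul m q)
  convert h1 using 1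
  rw [smul_eq_mul, mul_sub, pow_add, mul_assoc]
  abel

lemma good_all (r : Jacobson K) : GoodJ r := by
  have H : ∀ r : Jacobson K, GoodJ r → ∀ a : Jacobson K, GoodJ (a * r) := by
    intro r hr a
    revert r
    refine jac_induction (P := fun a => ∀ r : Jacobson K, GoodJ r → GoodJ (a * r))
      ?_ ?_ ?_ ?_ ?_ a
    · rintro a r ⟨n, q, h⟩
      refine ⟨n, C a * q, ?_⟩
      have h1 := (socJ K).smul_mem (algebraMap K (Jacobson K) a) h
      convert h1 using 1
      rw [smul_eq_mul, map_mul, aeval_C, mul_sub, ← mul_assoc, ← mul_assoc,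
        Algebra.commutes a (Yg K ^ n)]
    · rintro r ⟨n, q, h⟩
      refine ⟨n + 1, q, ?_⟩
      have h1 := sub_mem h ((socJ K).smul_mem (Yg K ^ n) (w_mul_mem r))
      convert h1 using 1
      rw [smul_eq_mul, pow_succ, wJ]
      simp only [sub_mul, mul_sub, mul_assoc, one_mul]
      abel
    · rintro r ⟨n, q, h⟩
      refine ⟨n, X ^ 1 * q, ?_⟩
      have h1 := good_raise 1 h
      rw [add_comm, pow_succ, mul_assoc] at h1
      exact h1
    · rintro a b ha hb r hr
      obtain ⟨n, q, h⟩ := ha r hr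
      obtain ⟨m, s, h'⟩ := hb r hr
      refine ⟨m + n, X ^ m * q + X ^ n * s, ?_⟩
      have h1 := good_raise m h
      have h2 := good_raise n h'
      rw [add_comm n m] at h2
      convert add_mem h1 h2 using 1
      rw [map_add, add_mul, mul_add]
      abel
    · rintro a b ha hb r hr
      rw [mul_assoc]
      exact ha _ (hb _ hr)
  have h1 : GoodJ (1 : Jacobson K) := ⟨0, 1, by simp⟩
  simpa using H 1 h1 r

lemma X_pow_mul_Y_pow (n : ℕ) : Xg K ^ n * Yg K ^ n = 1 := by
  induction n with
  | zero => simp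
  | succ n ih =>
    rw [pow_succ, pow_succ', mul_assoc, XY_assoc, ih]

lemma mem_of_Y_pow {I : Submodule (Jacobson K) (Jacobson K)} {n : ℕ} {r : Jacobson K}
    (h : Yg K ^ n * r ∈ I) : r ∈ I := by
  have := I.smul_mem (Xg K ^ n) h
  rwa [smul_eq_mul, ← mul_assoc, X_pow_mul_Y_pow, one_mul] at this

lemma aeval_split (p : K[X]) :
    aeval (cJ K) p = cJ K * aeval (cJ K) p.divX + algebraMap K (Jacobson K) (p.eval 0) := by
  conv_lhs => rw [← X_mul_divX_add p]
  rw [map_add, map_mul, aeval_X, aeval_C, coeff_zero_eq_eval_zero]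

lemma w_mul_c : wJ K * cJ K = 0 := by
  rw [cJ, pow_two, mul_assoc, w_mul_Y_assoc]

lemma wX_mul_c : wJ K * Xg K * cJ K = 0 := by
  rw [cJ, pow_two, mul_assoc, mul_assoc, XY_assoc, w_mul_Y_assoc]

lemma wX_mul_c' (n : ℕ) : wJ K * Xg K ^ (n + 2) * cJ K = wJ K * Xg K ^ (n + 1) := by
  rw [cJ, pow_two, pow_add, pow_two, pow_succ]
  simp only [mul_assoc, XY_assoc]

lemma wX_mul_aeval (n : ℕ) : ∀ q : K[X], ∃ s : ℕ → K,
    wJ K * Xg K ^ n * aeval (cJ K) q =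
      algebraMap K (Jacobson K) (q.eval 0) * (wJ K * Xg K ^ n) +
        ∑ i ∈ Finset.range n, algebraMap K (Jacobson K) (s i) * (wJ K * Xg K ^ i) := by
  induction n with
  | zero =>
    intro q
    refine ⟨0, ?_⟩
    rw [aeval_split, mul_add, ← mul_assoc, pow_zero, mul_one, w_mul_c, Algebra.commutes]
    simp
  | succ n ih =>
    intro q
    rw [aeval_split, mul_add, ← mul_assoc (wJ K * _)]
    cases n with
    | zero =>
      refine ⟨0, ?_⟩
      rw [zero_add, pow_one, wX_mul_c, Algebra.commutes]
      simp
    | succ n =>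
      obtain ⟨s, hs⟩ := ih q.divX
      refine ⟨fun i => if i = n + 1 then q.divX.eval 0 else s i, ?_⟩
      rw [wX_mul_c', hs, Finset.sum_range_succ _ (n + 1), ← Algebra.commutes]
      have : ∀ i ∈ Finset.range (n + 1), algebraMap K (Jacobson K)
          (if i = n + 1 then q.divX.eval 0 else s i) * (wJ K * Xg K ^ i) =
          algebraMap K (Jacobson K) (s i) * (wJ K * Xg K ^ i) := by
        intro i hi
        rw [if_neg (Finset.mem_range.1 hi).ne]
      rw [Finset.sum_congr rfl this]
      simp only [if_true]
      abel

lemma soc_le_span (p : K[X]) (hp : p.eval 0 ≠ 0) :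
    socJ K ≤ Submodule.span (Jacobson K) {aeval (cJ K) p} := by
  refine socJ_le _ fun n => ?_
  induction n using Nat.strong_induction_on with
  | _ n ih =>
    obtain ⟨s, hs⟩ := wX_mul_aeval n p
    set L := Submodule.span (Jacobson K) {aeval (cJ K) p} with hL
    have h1 : wJ K * Xg K ^ n * aeval (cJ K) p ∈ L :=
      L.smul_mem _ (Submodule.subset_span rfl)
    have h2 : ∑ i ∈ Finset.range n, algebraMap K (Jacobson K) (s i) * (wJ K * Xg K ^ i) ∈ L :=
      sum_mem fun i hi => L.smul_mem _ (ih i (Finset.mem_range.1 hi))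
    have h3 := sub_mem h1 h2
    rw [hs, add_sub_cancel_right] at h3
    have h4 := L.smul_mem (algebraMap K (Jacobson K) (p.eval 0)⁻¹) h3
    rwa [smul_eq_mul, ← mul_assoc, ← map_mul, inv_mul_cancel₀ hp, map_one, one_mul] at h4

end JacobsonProof

/-- Every left ideal of the Jacobson algebra properly containing the socle `J` is
principal, generated by `p(c)` for some polynomial `p` with nonzero constant term. -/
theorem ideal_above_socle_principal (I : Submodule (Jacobson K) (Jacobson K))
    (hI : socJ K < I) :
    ∃ p : Polynomial K, p.eval 0 ≠ 0 ∧
      I = Submodule.span (Jacobson K) {Polynomial.aeval (cJ K) p} := by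
  classical
  let A : Ideal (Polynomial K) :=
    { carrier := {q | Polynomial.aeval (cJ K) q ∈ I}
      add_mem' := fun {a b} ha hb => by
        simp only [Set.mem_ofPred_eq, map_add] at *
        exact add_mem ha hb
      zero_mem' := by simp
      smul_mem' := fun a b hb => by
        simp only [Set.mem_ofPred_eq, smul_eq_mul, map_mul] at *
        exact I.smul_mem _ hb }
  have hA : ∀ q, q ∈ A ↔ Polynomial.aeval (cJ K) q ∈ I := fun q => Iff.rfl
  have hJI := hI.le
  obtain ⟨p, hp⟩ := (IsPrincipalIdealRing.principal A).principal
  have hdvd : ∀ q, q ∈ A ↔ p ∣ q := fun q => by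
    rw [hp]; exact Ideal.mem_span_singleton
  have hp0 : p ≠ 0 := by
    rintro rfl
    obtain ⟨r, hrI, hrJ⟩ := SetLike.exists_of_lt hI
    obtain ⟨n, q, h⟩ := good_all r
    have hq : q ∈ A := by
      rw [hA]
      have h1 := sub_mem (I.smul_mem (Yg K ^ n) hrI) (hJI h)
      simpa using h1
    have hq0 : q = 0 := zero_dvd_iff.1 ((hdvd q).1 hq)
    rw [hq0, map_zero, sub_zero] at h
    exact hrJ (mem_of_Y_pow h)
  have hpA : Polynomial.aeval (cJ K) p ∈ I := (hA p).1 ((hdvd p).2 dvd_rfl)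
  have hpe : p.eval 0 ≠ 0 := by
    intro h0
    have h1 := aeval_split p
    rw [h0, map_zero, add_zero] at h1
    rw [h1] at hpA
    have h2 := add_mem (I.smul_mem (Xg K) hpA) (hJI (w_mul_mem (Polynomial.aeval (cJ K) p.divX)))
    have h3 : Polynomial.aeval (cJ K) p.divX ∈ I := by
      convert h2 using 1
      rw [smul_eq_mul, cJ, pow_two]
      simp only [mul_assoc, XY_assoc]
      rw [wJ, sub_mul, one_mul]
      simp only [mul_assoc]
      abel
    have h4 : p ∣ p.divX := (hdvd _).1 ((hA _).2 h3)
    have h5 : p = Polynomial.X * p.divX := by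
      conv_lhs => rw [← Polynomial.X_mul_divX_add p, Polynomial.coeff_zero_eq_eval_zero, h0]
      simp
    have h6 : p.divX ≠ 0 := by
      intro h; rw [h, mul_zero] at h5; exact hp0 h5
    have h7 := Polynomial.natDegree_le_of_dvd h4 h6
    have h8 := congrArg Polynomial.natDegree h5
    rw [Polynomial.natDegree_X_mul h6] at h8
    omega
  refine ⟨p, hpe, le_antisymm ?_ ?_⟩
  · intro r hr
    obtain ⟨n, q, h⟩ := good_all r
    have hq : q ∈ A := by
      rw [hA]
      have h1 := sub_mem (I.smul_mem (Yg K ^ n) hr) (hJI h)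
      simpa using h1
    obtain ⟨s, rfl⟩ := (hdvd q).1 hq
    have h1 := soc_le_span p hpe h
    have h2 : Polynomial.aeval (cJ K) (p * s) ∈
        Submodule.span (Jacobson K) {Polynomial.aeval (cJ K) p} := by
      rw [mul_comm, map_mul]
      exact Submodule.smul_mem _ _ (Submodule.subset_span rfl)
    have h3 := add_mem h1 h2
    rw [sub_add_cancel] at h3
    exact mem_of_Y_pow h3
  · rw [Submodule.span_le]
    rintro x hx
    rw [Set.mem_singleton_iff.1 hx]
    exact hpA
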